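/- arXiv:1309.5603 — 2 statements merged into one kernel-verified Lean document; each statement's English description precedes it below -/
import Mathlib

section
/- Fixed Proportion Decomposition, finite irrationality exponent: Fix L > 0 and p ∈ (0,1), let y = log₁₀((1−p)/p), and suppose y is irrational with finite irrationality exponent, i.e., there exist κ ≥ 1 and c > 0 such that |y − a/q| ≥ c·q^{−(κ+1)} for all integers a and all positive integers q. Then there exist η > 0 and C > 0 such that for all N ≥ 1 and all s ∈ [1,10), |Σ_{k=0}^{N} 2^{−N} · C(N,k) · φ_s(L·p^{N−k}·(1−p)^k) − log₁₀ s| ≤ C·N^{−η}. -/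
open Filter

/-- Base-10 significand: for `x > 0`, `x = signif x * 10 ^ k` with `signif x ∈ [1,10)`. -/
noncomputable def signif (x : ℝ) : ℝ := x / (10 : ℝ) ^ (⌊Real.logb 10 x⌋)

/-- `phi s x = 1` if the significand of `x` is at most `s`, else `0`. -/
noncomputable def phi (s x : ℝ) : ℝ := if signif x ≤ s then 1 else 0

/-- The proportion of the `2^N` pieces of the fixed-proportion decomposition whose
significand is at most `s`: length `L p^{N-k} (1-p)^k` occurs with multiplicity `C(N,k)`. -/
noncomputable def fixedP (L p : ℝ) (N : ℕ) (s : ℝ) : ℝ :=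
  ∑ k ∈ Finset.range (N + 1),
    (1 / 2 ^ N : ℝ) * (N.choose k : ℝ) * phi s (L * p ^ (N - k) * (1 - p) ^ k)

/-- The binomial average of `cos` along an arithmetic progression. -/
theorem abs_binomial_sum_cos_le (N : ℕ) (φ ψ : ℝ) :
    |∑ k ∈ Finset.range (N + 1), (1 / 2 ^ N : ℝ) * (N.choose k : ℝ) * Real.cos (φ + k * ψ)|
      ≤ |Real.cos (ψ / 2)| ^ N := by
  have hsum : ∑ k ∈ Finset.range (N + 1),
      (1 / 2 ^ N : ℝ) * (N.choose k : ℝ) * Real.cos (φ + k * ψ)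
      = (Complex.exp (φ * Complex.I) *
          ((Complex.exp (ψ * Complex.I) + 1) / 2) ^ N).re := by
    rw [div_pow, add_pow, Finset.sum_div, Finset.mul_sum, Complex.re_sum]
    refine Finset.sum_congr rfl fun k _ => ?_
    have : Complex.exp (φ * Complex.I) *
        (Complex.exp (ψ * Complex.I) ^ k * 1 ^ (N - k) * (N.choose k : ℂ) / 2 ^ N)
        = (((1 / 2 ^ N : ℝ) * (N.choose k : ℝ) : ℝ) : ℂ) *
          Complex.exp (((φ + k * ψ : ℝ) : ℂ) * Complex.I) := by
      rw [← Complex.exp_nat_mul]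
      push_cast
      rw [add_mul, Complex.exp_add, one_pow, mul_assoc (k : ℂ)]
      ring
    rw [this, Complex.re_ofReal_mul, Complex.exp_ofReal_mul_I_re]
  have hnorm : ‖(Complex.exp (ψ * Complex.I) + 1) / 2‖ = |Real.cos (ψ / 2)| := by
    have : (Complex.exp (ψ * Complex.I) + 1) / 2
        = Complex.exp ((ψ / 2 : ℝ) * Complex.I) * (Real.cos (ψ / 2) : ℝ) := by
      have h : Complex.exp (ψ * Complex.I) =
          Complex.exp ((ψ / 2 : ℝ) * Complex.I) * Complex.exp ((ψ / 2 : ℝ) * Complex.I) := by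
        rw [← Complex.exp_add]
        congr 1
        push_cast
        ring
      have h' : Complex.exp ((ψ / 2 : ℝ) * Complex.I) *
          Complex.exp (-(ψ / 2 : ℝ) * Complex.I) = 1 := by
        rw [← Complex.exp_add, neg_mul, add_neg_cancel, Complex.exp_zero]
      rw [Complex.ofReal_cos, Complex.cos, h]
      linear_combination (-(1 : ℂ) / 2) * h'
    rw [this, norm_mul, Complex.norm_exp_ofReal_mul_I, one_mul, Complex.norm_real,
      Real.norm_eq_abs]
  rw [hsum]
  refine (Complex.abs_re_le_norm _).trans ?_
  rw [norm_mul, Complex.norm_exp_ofReal_mul_I, one_mul, norm_pow, hnorm]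

/-- The `1`-periodic extension of the second Bernoulli polynomial. -/
noncomputable def periodicBernoulliTwo (x : ℝ) : ℝ := Int.fract x ^ 2 - Int.fract x + 1 / 6

theorem hasSum_cos_periodicBernoulliTwo (x : ℝ) :
    HasSum (fun n : ℕ => 1 / (n : ℝ) ^ 2 * Real.cos (2 * Real.pi * n * x))
      (Real.pi ^ 2 * periodicBernoulliTwo x) := by
  have h := hasSum_one_div_nat_pow_mul_cos (k := 1) one_ne_zero
    (x := Int.fract x) ⟨Int.fract_nonneg x, (Int.fract_lt_one x).le⟩
  convert h using 1
  · funext n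
    have : 2 * Real.pi * n * x
        = 2 * Real.pi * n * Int.fract x + ((n * ⌊x⌋ : ℤ) : ℝ) * (2 * Real.pi) := by
      rw [Int.fract]
      push_cast
      ring
    rw [this, Real.cos_add_int_mul_two_pi]
  · have hb : ((Polynomial.bernoulli 2).map (algebraMap ℚ ℝ)).eval (Int.fract x)
        = Int.fract x ^ 2 - Int.fract x + 1 / 6 := by
      simp [Polynomial.bernoulli, Finset.sum_range_succ, bernoulli_one, bernoulli_two]
      ring
    rw [mul_one, hb, periodicBernoulliTwo]
    simp only [mul_one, Nat.factorial]
    push_cast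
    ring

theorem periodicBernoulliTwo_add_sub_le (x δ : ℝ) :
    periodicBernoulliTwo (x + δ) - periodicBernoulliTwo x
      ≤ 2 * δ * (Int.fract x - 1 / 2) + δ ^ 2 := by
  obtain ⟨m, hm⟩ : ∃ m : ℤ, Int.fract (x + δ) = Int.fract x + δ - m :=
    ⟨⌊x + δ⌋ - ⌊x⌋, by rw [Int.fract, Int.fract]; push_cast; ring⟩
  have h0 := Int.fract_nonneg (x + δ)
  have h1 := Int.fract_lt_one (x + δ)
  have key : (m : ℝ) ^ 2 + m ≤ 2 * m * (Int.fract x + δ) := by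
    rw [hm] at h0 h1
    rcases le_or_gt 0 m with h | h
    · rcases h.eq_or_lt with rfl | h
      · simp
      · have : (1 : ℝ) ≤ m := by exact_mod_cast h
        nlinarith
    · have : (m : ℝ) ≤ -1 := by exact_mod_cast (by omega : m ≤ -1)
      nlinarith
  rw [periodicBernoulliTwo, periodicBernoulliTwo, hm]
  nlinarith

theorem sum_binomial_weights (N : ℕ) :
    ∑ k ∈ Finset.range (N + 1), (1 / 2 ^ N : ℝ) * (N.choose k : ℝ) = 1 := by
  rw [← Finset.mul_sum]
  have : ∑ k ∈ Finset.range (N + 1), (N.choose k : ℝ) = 2 ^ N := by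
    exact_mod_cast Nat.sum_range_choose N
  rw [this]
  field_simp

/-- Smoothing: control of the averages of `periodicBernoulliTwo` along all translates controls
the average of the sawtooth function. -/
theorem abs_sum_sawtooth_le {N : ℕ} {θ B δ : ℝ} (hδ : 0 < δ)
    (hB : ∀ α : ℝ, |∑ k ∈ Finset.range (N + 1),
      (1 / 2 ^ N : ℝ) * (N.choose k : ℝ) * periodicBernoulliTwo (α + k * θ)| ≤ B) (α : ℝ) :
    |∑ k ∈ Finset.range (N + 1),
      (1 / 2 ^ N : ℝ) * (N.choose k : ℝ) * (Int.fract (α + k * θ) - 1 / 2)| ≤ δ / 2 + B / δ := by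
  have key : ∀ d : ℝ, -(2 * B) ≤ 2 * d * (∑ k ∈ Finset.range (N + 1),
      (1 / 2 ^ N : ℝ) * (N.choose k : ℝ) * (Int.fract (α + k * θ) - 1 / 2)) + d ^ 2 := by
    intro d
    have h : ∑ k ∈ Finset.range (N + 1), (1 / 2 ^ N : ℝ) * (N.choose k : ℝ) *
          (periodicBernoulliTwo (α + k * θ + d) - periodicBernoulliTwo (α + k * θ))
        ≤ ∑ k ∈ Finset.range (N + 1), (1 / 2 ^ N : ℝ) * (N.choose k : ℝ) *
          (2 * d * (Int.fract (α + k * θ) - 1 / 2) + d ^ 2) :=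
      Finset.sum_le_sum fun k _ => mul_le_mul_of_nonneg_left
        (periodicBernoulliTwo_add_sub_le _ _) (by positivity)
    have hr : ∑ k ∈ Finset.range (N + 1), (1 / 2 ^ N : ℝ) * (N.choose k : ℝ) *
          (2 * d * (Int.fract (α + k * θ) - 1 / 2) + d ^ 2)
        = 2 * d * (∑ k ∈ Finset.range (N + 1),
          (1 / 2 ^ N : ℝ) * (N.choose k : ℝ) * (Int.fract (α + k * θ) - 1 / 2)) + d ^ 2 := by
      have hw : d ^ 2 = ∑ k ∈ Finset.range (N + 1),
          (1 / 2 ^ N : ℝ) * (N.choose k : ℝ) * d ^ 2 := by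
        rw [← Finset.sum_mul, sum_binomial_weights, one_mul]
      conv_rhs => rw [hw]
      rw [Finset.mul_sum, ← Finset.sum_add_distrib]
      exact Finset.sum_congr rfl fun k _ => by ring
    have hl : ∑ k ∈ Finset.range (N + 1), (1 / 2 ^ N : ℝ) * (N.choose k : ℝ) *
          (periodicBernoulliTwo (α + k * θ + d) - periodicBernoulliTwo (α + k * θ))
        = (∑ k ∈ Finset.range (N + 1),
            (1 / 2 ^ N : ℝ) * (N.choose k : ℝ) * periodicBernoulliTwo (α + d + k * θ))
          - ∑ k ∈ Finset.range (N + 1),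
            (1 / 2 ^ N : ℝ) * (N.choose k : ℝ) * periodicBernoulliTwo (α + k * θ) := by
      rw [← Finset.sum_sub_distrib]
      exact Finset.sum_congr rfl fun k _ => by rw [add_right_comm, mul_sub]
    rw [hl, hr] at h
    have h1 := abs_le.1 (hB (α + d))
    have h2 := abs_le.1 (hB α)
    linarith [h1.1, h2.2]
  have h1 := key δ
  have h2 := key (-δ)
  have hdiv : δ / 2 + B / δ = (δ ^ 2 / 2 + B) / δ := by field_simp
  rw [hdiv, le_div_iff₀ hδ, ← abs_of_pos hδ, ← abs_mul, abs_of_pos hδ, abs_le]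
  constructor <;> linarith

theorem exp_neg_le_rpow_neg {a ε : ℝ} (ha : 0 < a) (hε : 0 ≤ ε) (hε1 : ε ≤ 1) :
    Real.exp (-a) ≤ a ^ (-ε) := by
  rcases le_total a 1 with h | h
  · exact (Real.exp_le_one_iff.2 (by linarith)).trans
      (Real.one_le_rpow_of_pos_of_le_one_of_nonpos ha h (by linarith))
  · calc Real.exp (-a) ≤ a⁻¹ := by
          rw [Real.exp_neg]
          exact inv_anti₀ ha (by linarith [Real.add_one_le_exp a])
      _ = a ^ (-1 : ℝ) := (Real.rpow_neg_one a).symm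
      _ ≤ a ^ (-ε) := Real.rpow_le_rpow_of_exponent_le h (by linarith)

/-- If `x` stays at distance `d` from the integers then `|cos (π x)|` stays away from `1`. -/
theorem abs_cos_pi_mul_pow_le {x d : ℝ} (hd : 0 ≤ d) (h : ∀ a : ℤ, d ≤ |x - a|) (N : ℕ) :
    |Real.cos (Real.pi * x)| ^ N ≤ Real.exp (-(2 * d ^ 2 * N)) := by
  set r := x - round x with hr
  have hr2 : |r| ≤ 1 / 2 := abs_sub_round x
  have hdr : d ≤ |r| := h (round x)
  have hcos : |Real.cos (Real.pi * x)| = |Real.cos (Real.pi * r)| := by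
    have : Real.pi * x = Real.pi * r + (round x : ℤ) * Real.pi := by rw [hr]; ring
    rw [this, Real.cos_add_int_mul_pi, abs_mul, abs_zpow, abs_neg, abs_one, one_zpow, one_mul]
  have hsin : 2 * |r| ≤ Real.sin (Real.pi * |r|) := by
    have := Real.mul_le_sin (x := Real.pi * |r|) (by positivity)
      (by nlinarith [Real.pi_pos])
    calc 2 * |r| = 2 / Real.pi * (Real.pi * |r|) := by field_simp
      _ ≤ _ := this
  have habs : Real.cos (Real.pi * r) = Real.cos (Real.pi * |r|) := by
    rw [← Real.cos_abs, abs_mul, abs_of_pos Real.pi_pos]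
  have hsq : |Real.cos (Real.pi * x)| ^ 2 ≤ Real.exp (-(2 * d ^ 2)) ^ 2 := by
    rw [hcos, sq_abs, habs, ← Real.exp_nat_mul]
    have h1 := Real.sin_sq_add_cos_sq (Real.pi * |r|)
    have h2 := Real.add_one_le_exp (((2 : ℕ) : ℝ) * -(2 * d ^ 2))
    push_cast at h2 ⊢
    nlinarith [abs_nonneg r]
  have hle := (sq_le_sq₀ (abs_nonneg _) (Real.exp_pos _).le).1 hsq
  calc |Real.cos (Real.pi * x)| ^ N ≤ Real.exp (-(2 * d ^ 2)) ^ N :=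
        pow_le_pow_left₀ (abs_nonneg _) hle N
    _ = _ := by
        rw [← Real.exp_nat_mul]
        ring_nf

theorem abs_cos_pow_le_of_irrationality_exponent {θ κ c : ℝ} (hκ : 1 ≤ κ) (hc : 0 < c)
    (hy : ∀ (a : ℤ) (q : ℕ), 0 < q → c * (q : ℝ) ^ (-(κ + 1)) ≤ |θ - (a : ℝ) / (q : ℝ)|)
    {n N : ℕ} (hn : 0 < n) (hN : 0 < N) :
    |Real.cos (Real.pi * (n * θ))| ^ N
      ≤ (2 * c ^ 2) ^ (-(1 / (4 * κ))) * (N : ℝ) ^ (-(1 / (4 * κ))) * (n : ℝ) ^ (1 / 2 : ℝ) := by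
  have hn' : (0 : ℝ) < n := by exact_mod_cast hn
  have hN' : (0 : ℝ) < N := by exact_mod_cast hN
  have hκ0 : 0 < κ := by linarith
  have hd : ∀ a : ℤ, c * (n : ℝ) ^ (-κ) ≤ |n * θ - a| := by
    intro a
    have h := mul_le_mul_of_nonneg_left (hy a n hn) hn'.le
    have e1 : (n : ℝ) * (c * (n : ℝ) ^ (-(κ + 1))) = c * (n : ℝ) ^ (-κ) := by
      have : (n : ℝ) ^ (-κ) = (n : ℝ) ^ (-(κ + 1)) * n := by
        rw [← Real.rpow_add_one hn'.ne']
        congr 1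
        ring
      rw [this]
      ring
    have e2 : (n : ℝ) * |θ - a / n| = |n * θ - a| := by
      rw [← abs_of_pos hn', ← abs_mul, abs_of_pos hn']
      congr 1
      field_simp
    rwa [e1, e2] at h
  refine (abs_cos_pi_mul_pow_le (by positivity) hd N).trans ?_
  refine (exp_neg_le_rpow_neg (ε := 1 / (4 * κ)) (by positivity) (by positivity) ?_).trans ?_
  · rw [div_le_one (by positivity)]
    linarith
  · have e : 2 * (c * (n : ℝ) ^ (-κ)) ^ 2 * N = 2 * c ^ 2 * N * (n : ℝ) ^ (-(2 * κ)) := by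
      have : (n : ℝ) ^ (-(2 * κ)) = ((n : ℝ) ^ (-κ)) ^ 2 := by
        rw [← Real.rpow_mul_natCast hn'.le]
        congr 1
        push_cast
        ring
      rw [this]
      ring
    rw [e, Real.mul_rpow (by positivity) (by positivity),
      Real.mul_rpow (by positivity) (by positivity), ← Real.rpow_mul hn'.le]
    have : -(2 * κ) * -(1 / (4 * κ)) = 1 / 2 := by
      field_simp
      norm_num
    rw [this]

/-- Decay of the binomial averages of `periodicBernoulliTwo` along a progression whose step has
finite irrationality exponent. -/
theorem exists_abs_sum_periodicBernoulliTwo_le {θ κ c : ℝ} (hκ : 1 ≤ κ) (hc : 0 < c)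
    (hy : ∀ (a : ℤ) (q : ℕ), 0 < q → c * (q : ℝ) ^ (-(κ + 1)) ≤ |θ - (a : ℝ) / (q : ℝ)|) :
    ∃ K > (0 : ℝ), ∀ N : ℕ, 1 ≤ N → ∀ α : ℝ, |∑ k ∈ Finset.range (N + 1),
      (1 / 2 ^ N : ℝ) * (N.choose k : ℝ) * periodicBernoulliTwo (α + k * θ)|
        ≤ K * (N : ℝ) ^ (-(1 / (4 * κ))) := by
  set S : ℝ := ∑' n : ℕ, 1 / (n : ℝ) ^ (3 / 2 : ℝ) with hS
  have hsum : HasSum (fun n : ℕ => 1 / (n : ℝ) ^ (3 / 2 : ℝ)) S :=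
    (Real.summable_one_div_nat_rpow.2 (by norm_num)).hasSum
  have hS0 : 0 ≤ S := tsum_nonneg fun n => by positivity
  refine ⟨(2 * c ^ 2) ^ (-(1 / (4 * κ))) * (S + 1), by positivity, fun N hN α => ?_⟩
  set M : ℝ := (2 * c ^ 2) ^ (-(1 / (4 * κ))) * (N : ℝ) ^ (-(1 / (4 * κ))) with hM
  have hM0 : 0 ≤ M := by positivity
  have h1 : HasSum (fun n : ℕ => ∑ k ∈ Finset.range (N + 1), (1 / 2 ^ N : ℝ) * (N.choose k : ℝ) *
        (1 / (n : ℝ) ^ 2 * Real.cos (2 * Real.pi * n * (α + k * θ))))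
      (∑ k ∈ Finset.range (N + 1), (1 / 2 ^ N : ℝ) * (N.choose k : ℝ) *
        (Real.pi ^ 2 * periodicBernoulliTwo (α + k * θ))) :=
    hasSum_sum fun k _ => (hasSum_cos_periodicBernoulliTwo _).mul_left _
  have hterm : ∀ n : ℕ, ‖∑ k ∈ Finset.range (N + 1), (1 / 2 ^ N : ℝ) * (N.choose k : ℝ) *
        (1 / (n : ℝ) ^ 2 * Real.cos (2 * Real.pi * n * (α + k * θ)))‖
      ≤ M * (1 / (n : ℝ) ^ (3 / 2 : ℝ)) := by
    intro n
    rcases Nat.eq_zero_or_pos n with rfl | hn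
    · simp
    have hn' : (0 : ℝ) < n := by exact_mod_cast hn
    have e : ∑ k ∈ Finset.range (N + 1), (1 / 2 ^ N : ℝ) * (N.choose k : ℝ) *
          (1 / (n : ℝ) ^ 2 * Real.cos (2 * Real.pi * n * (α + k * θ)))
        = 1 / (n : ℝ) ^ 2 * ∑ k ∈ Finset.range (N + 1), (1 / 2 ^ N : ℝ) * (N.choose k : ℝ) *
          Real.cos (2 * Real.pi * n * α + k * (2 * Real.pi * n * θ)) := by
      rw [Finset.mul_sum]
      refine Finset.sum_congr rfl fun k _ => ?_
      rw [show 2 * Real.pi * n * (α + k * θ)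
        = 2 * Real.pi * n * α + k * (2 * Real.pi * n * θ) by ring]
      ring
    have hhalf : 2 * Real.pi * n * θ / 2 = Real.pi * (n * θ) := by ring
    have hpow : (n : ℝ) ^ (1 / 2 : ℝ) * (n : ℝ) ^ (3 / 2 : ℝ) = (n : ℝ) ^ 2 := by
      rw [← Real.rpow_add hn', ← Real.rpow_natCast]
      norm_num
    rw [e, Real.norm_eq_abs, abs_mul, abs_of_pos (by positivity : 0 < 1 / (n : ℝ) ^ 2)]
    have hbound := (abs_binomial_sum_cos_le N (2 * Real.pi * n * α) (2 * Real.pi * n * θ)).trans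
      (hhalf ▸ abs_cos_pow_le_of_irrationality_exponent hκ hc hy hn hN)
    calc _ ≤ 1 / (n : ℝ) ^ 2 * (M * (n : ℝ) ^ (1 / 2 : ℝ)) :=
          mul_le_mul_of_nonneg_left hbound (by positivity)
      _ = M * (1 / (n : ℝ) ^ (3 / 2 : ℝ)) := by
          rw [← hpow]
          field_simp
  have h2 : ‖∑ k ∈ Finset.range (N + 1), (1 / 2 ^ N : ℝ) * (N.choose k : ℝ) *
      (Real.pi ^ 2 * periodicBernoulliTwo (α + k * θ))‖ ≤ M * S := by
    rw [← h1.tsum_eq]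
    exact tsum_of_norm_bounded (hsum.mul_left M) hterm
  have h3 : ∑ k ∈ Finset.range (N + 1), (1 / 2 ^ N : ℝ) * (N.choose k : ℝ) *
      (Real.pi ^ 2 * periodicBernoulliTwo (α + k * θ))
      = Real.pi ^ 2 * ∑ k ∈ Finset.range (N + 1),
        (1 / 2 ^ N : ℝ) * (N.choose k : ℝ) * periodicBernoulliTwo (α + k * θ) := by
    rw [Finset.mul_sum]
    exact Finset.sum_congr rfl fun k _ => by ring
  have hpi : (1 : ℝ) ≤ Real.pi ^ 2 := by nlinarith [Real.pi_gt_three]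
  rw [h3, Real.norm_eq_abs, abs_mul, abs_of_pos (by positivity : 0 < Real.pi ^ 2)] at h2
  calc _ ≤ Real.pi ^ 2 * |∑ k ∈ Finset.range (N + 1),
        (1 / 2 ^ N : ℝ) * (N.choose k : ℝ) * periodicBernoulliTwo (α + k * θ)| :=
        le_mul_of_one_le_left (abs_nonneg _) hpi
    _ ≤ M * S := h2
    _ ≤ M * (S + 1) := by gcongr; linarith
    _ = _ := by rw [hM]; ring

theorem exists_abs_sum_sawtooth_le {θ κ c : ℝ} (hκ : 1 ≤ κ) (hc : 0 < c)
    (hy : ∀ (a : ℤ) (q : ℕ), 0 < q → c * (q : ℝ) ^ (-(κ + 1)) ≤ |θ - (a : ℝ) / (q : ℝ)|) :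
    ∃ K > (0 : ℝ), ∀ N : ℕ, 1 ≤ N → ∀ α : ℝ, |∑ k ∈ Finset.range (N + 1),
      (1 / 2 ^ N : ℝ) * (N.choose k : ℝ) * (Int.fract (α + k * θ) - 1 / 2)|
        ≤ K * (N : ℝ) ^ (-(1 / (8 * κ))) := by
  obtain ⟨K, hK, h⟩ := exists_abs_sum_periodicBernoulliTwo_le hκ hc hy
  refine ⟨1 / 2 + K, by positivity, fun N hN α => ?_⟩
  have hN' : (0 : ℝ) < N := by exact_mod_cast hN
  have hδ : 0 < (N : ℝ) ^ (-(1 / (8 * κ))) := by positivity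
  refine (abs_sum_sawtooth_le hδ (h N hN) α).trans_eq ?_
  have : (N : ℝ) ^ (-(1 / (4 * κ))) = (N : ℝ) ^ (-(1 / (8 * κ))) * (N : ℝ) ^ (-(1 / (8 * κ))) := by
    rw [← Real.rpow_add hN']
    congr 1
    field_simp
    norm_num
  rw [this]
  field_simp

theorem signif_le_iff {s x : ℝ} (hs : 0 < s) (hx : 0 < x) :
    signif x ≤ s ↔ Int.fract (Real.logb 10 x) ≤ Real.logb 10 s := by
  have : signif x = (10 : ℝ) ^ Int.fract (Real.logb 10 x) := by
    rw [signif, Int.fract, Real.rpow_sub (by norm_num), Real.rpow_logb (by norm_num) (by norm_num)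
      hx, Real.rpow_intCast]
  rw [this, Real.le_logb_iff_rpow_le (by norm_num) hs]

theorem ite_fract_le_eq {x t : ℝ} (ht0 : 0 ≤ t) (ht1 : t < 1) :
    (if Int.fract x ≤ t then 1 else 0 : ℝ)
      = t - (Int.fract (t - x) - 1 / 2) - (Int.fract x - 1 / 2) := by
  have h0 := Int.fract_nonneg x
  have h1 := Int.fract_lt_one x
  split_ifs with h
  · have : Int.fract (t - x) = t - Int.fract x :=
      Int.fract_eq_iff.2 ⟨by linarith, by linarith, -⌊x⌋, by rw [Int.fract]; push_cast; ring⟩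
    rw [this]
    ring
  · have : Int.fract (t - x) = t - Int.fract x + 1 :=
      Int.fract_eq_iff.2 ⟨by linarith, by linarith, -⌊x⌋ - 1, by rw [Int.fract]; push_cast; ring⟩
    rw [this]
    ring

theorem phi_fixed_proportion_eq {L p s : ℝ} (hL : 0 < L) (hp : p ∈ Set.Ioo (0 : ℝ) 1)
    (hs : s ∈ Set.Ico (1 : ℝ) 10) {N k : ℕ} (hk : k ≤ N) :
    phi s (L * p ^ (N - k) * (1 - p) ^ k) = Real.logb 10 s
      - (Int.fract (Real.logb 10 s - (Real.logb 10 L + N * Real.logb 10 p)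
          + k * -Real.logb 10 ((1 - p) / p)) - 1 / 2)
      - (Int.fract (Real.logb 10 L + N * Real.logb 10 p
          + k * Real.logb 10 ((1 - p) / p)) - 1 / 2) := by
  have hp0 : 0 < p := hp.1
  have hq0 : 0 < 1 - p := sub_pos.2 hp.2
  have hs0 : 0 < s := by linarith [hs.1]
  have hlog : Real.logb 10 (L * p ^ (N - k) * (1 - p) ^ k)
      = Real.logb 10 L + N * Real.logb 10 p + k * Real.logb 10 ((1 - p) / p) := by
    rw [Real.logb_mul (by positivity) (by positivity), Real.logb_mul (by positivity)
      (by positivity), Real.logb_pow, Real.logb_pow, Real.logb_div hq0.ne' hp0.ne',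
      Nat.cast_sub hk]
    ring
  have ht1 : Real.logb 10 s < 1 := by
    rw [Real.logb_lt_iff_lt_rpow (by norm_num) hs0, Real.rpow_one]
    exact hs.2
  rw [phi]
  simp only [signif_le_iff hs0 (by positivity : 0 < L * p ^ (N - k) * (1 - p) ^ k)]
  rw [ite_fract_le_eq (Real.logb_nonneg (by norm_num) hs.1) ht1, hlog]
  ring_nf

/-- **Fixed Proportion Decomposition, finite irrationality exponent**: if
`y = log₁₀((1-p)/p)` satisfies `|y - a/q| ≥ c q^{-(κ+1)}` for all integers `a` and positive
integers `q`, then the convergence to Benford's Law has a power savings `C N^{-η}`. -/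
theorem fixedProportion_finite_irrationality_exponent_rate
    (L : ℝ) (hL : 0 < L) (p : ℝ) (hp : p ∈ Set.Ioo (0 : ℝ) 1)
    (κ : ℝ) (hκ : 1 ≤ κ) (c : ℝ) (hc : 0 < c)
    (hy : ∀ (a : ℤ) (q : ℕ), 0 < q →
      c * (q : ℝ) ^ (-(κ + 1)) ≤ |Real.logb 10 ((1 - p) / p) - (a : ℝ) / (q : ℝ)|) :
    ∃ η > (0 : ℝ), ∃ C > (0 : ℝ), ∀ N : ℕ, 1 ≤ N → ∀ s ∈ Set.Ico (1 : ℝ) 10,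
      |fixedP L p N s - Real.logb 10 s| ≤ C * (N : ℝ) ^ (-η) := by
  have hy' : ∀ (a : ℤ) (q : ℕ), 0 < q →
      c * (q : ℝ) ^ (-(κ + 1)) ≤ |-Real.logb 10 ((1 - p) / p) - (a : ℝ) / (q : ℝ)| := by
    intro a q hq
    have h := hy (-a) q hq
    rw [← abs_neg] at h
    convert h using 2
    push_cast
    ring
  obtain ⟨K₁, hK₁, h₁⟩ := exists_abs_sum_sawtooth_le hκ hc hy
  obtain ⟨K₂, hK₂, h₂⟩ := exists_abs_sum_sawtooth_le hκ hc hy'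
  refine ⟨1 / (8 * κ), by positivity, K₁ + K₂, by positivity, fun N hN s hs => ?_⟩
  have h₁ := h₁ N hN (Real.logb 10 L + N * Real.logb 10 p)
  have h₂ := h₂ N hN (Real.logb 10 s - (Real.logb 10 L + N * Real.logb 10 p))
  have hsplit : fixedP L p N s - Real.logb 10 s
      = -(∑ k ∈ Finset.range (N + 1), (1 / 2 ^ N : ℝ) * (N.choose k : ℝ) *
          (Int.fract (Real.logb 10 L + N * Real.logb 10 p
            + k * Real.logb 10 ((1 - p) / p)) - 1 / 2))
        - ∑ k ∈ Finset.range (N + 1), (1 / 2 ^ N : ℝ) * (N.choose k : ℝ) *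
          (Int.fract (Real.logb 10 s - (Real.logb 10 L + N * Real.logb 10 p)
            + k * -Real.logb 10 ((1 - p) / p)) - 1 / 2) := by
    conv_lhs => rw [← one_mul (Real.logb 10 s), ← sum_binomial_weights N]
    rw [fixedP, Finset.sum_mul, ← Finset.sum_sub_distrib, ← Finset.sum_neg_distrib,
      ← Finset.sum_sub_distrib]
    refine Finset.sum_congr rfl fun k hk => ?_
    rw [phi_fixed_proportion_eq hL hp hs (Nat.lt_succ_iff.1 (Finset.mem_range.1 hk))]
    ring
  rw [hsplit, add_mul]
  refine (abs_sub _ _).trans ?_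
  rw [abs_neg]
  exact add_le_add h₁ h₂
end

section
/- Quantified equidistribution of binomial residue classes: Let q ≥ 1 and j be integers with 0 ≤ j < q, and let N ≥ 1. Then |2^{−N} · Σ_{ℓ ≥ 0, ℓq+j ≤ N} C(N, ℓq+j) − 1/q| ≤ ((q−1)/q)·(cos(π/q))^N. -/
/-- Orthogonality of the powers of a primitive root of unity. -/
theorem IsPrimitiveRoot.sum_range_pow_mul_eq_ite {R : Type*} [CommRing R] [IsDomain R]
    {ζ : R} {q : ℕ} (h : IsPrimitiveRoot ζ q) (m : ℕ) :
    ∑ r ∈ Finset.range q, ζ ^ (r * m) = if q ∣ m then (q : R) else 0 := by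
  have hpow : ∀ r ∈ Finset.range q, ζ ^ (r * m) = (ζ ^ m) ^ r := fun r _ => by
    rw [← pow_mul, mul_comm]
  rw [Finset.sum_congr rfl hpow]
  split_ifs with hm
  · simp [(h.pow_eq_one_iff_dvd m).2 hm]
  · have hne : ζ ^ m - 1 ≠ 0 := fun h0 =>
      hm ((h.pow_eq_one_iff_dvd m).1 (sub_eq_zero.1 h0))
    refine (mul_eq_zero.1 ?_).resolve_right hne
    rw [geom_sum_mul, ← pow_mul, mul_comm, pow_mul, h.pow_eq_one, one_pow, sub_self]

/-- The roots of unity filter applied to `(1 + X) ^ N`. -/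
theorem IsPrimitiveRoot.sum_range_pow_mul_one_add_pow {R : Type*} [CommRing R] [IsDomain R]
    {ζ : R} {q : ℕ} (h : IsPrimitiveRoot ζ q) {j : ℕ} (hj : j < q) (N : ℕ) :
    ∑ r ∈ Finset.range q, ζ ^ (r * (q - j)) * (1 + ζ ^ r) ^ N =
      q * ∑ k ∈ Finset.range (N + 1), if k % q = j then (N.choose k : R) else 0 := by
  have hexp : ∀ r ∈ Finset.range q, ζ ^ (r * (q - j)) * (1 + ζ ^ r) ^ N =
      ∑ k ∈ Finset.range (N + 1), ζ ^ (r * (k + (q - j))) * (N.choose k : R) := fun r _ => by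
    rw [add_comm 1, add_pow, Finset.mul_sum]
    refine Finset.sum_congr rfl fun k _ => ?_
    rw [one_pow, ← pow_mul, mul_add, pow_add]
    ring
  rw [Finset.sum_congr rfl hexp, Finset.sum_comm, Finset.mul_sum]
  refine Finset.sum_congr rfl fun k _ => ?_
  have hdvd : q ∣ k + (q - j) ↔ k % q = j := by
    have hmod : (k + (q - j)) ≡ 0 [MOD q] ↔ k ≡ j [MOD q] := by
      rw [← Nat.ModEq.add_iff_right (c := j) (d := j) rfl]
      have hk : k + (q - j) + j = k + q := by omega
      rw [hk, zero_add]
      simp [Nat.ModEq]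
    rw [← Nat.modEq_zero_iff_dvd, hmod, Nat.ModEq, Nat.mod_eq_of_lt hj]
  rw [← Finset.sum_mul, h.sum_range_pow_mul_eq_ite]
  simp only [hdvd]
  split_ifs <;> simp

/-- A sum over an arithmetic progression as a sum over a residue class. -/
theorem Finset.sum_range_ite_mul_add_le {M : Type*} [AddCommMonoid M] {q j : ℕ} (hj : j < q)
    (N : ℕ) (f : ℕ → M) :
    (∑ l ∈ Finset.range (N + 1), if l * q + j ≤ N then f (l * q + j) else 0) =
      ∑ k ∈ Finset.range (N + 1), if k % q = j then f k else 0 := by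
  rw [← Finset.sum_filter, ← Finset.sum_filter]
  refine Finset.sum_nbij' (fun l => l * q + j) (fun k => k / q) ?_ ?_ ?_ ?_ ?_
  · intro l hl
    simp only [Finset.mem_filter, Finset.mem_range] at hl ⊢
    refine ⟨by omega, ?_⟩
    rw [Nat.mul_add_mod_self_right, Nat.mod_eq_of_lt hj]
  · intro k hk
    simp only [Finset.mem_filter, Finset.mem_range] at hk ⊢
    have h1 := Nat.div_add_mod' k q
    have h2 := Nat.div_le_self k q
    rw [hk.2] at h1
    omega
  · intro l _
    have hq : 0 < q := by omega
    rw [mul_comm, Nat.mul_add_div hq, Nat.div_eq_of_lt hj, add_zero]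
  · intro k hk
    have h1 := Nat.div_add_mod' k q
    rwa [(Finset.mem_filter.1 hk).2] at h1
  · intro l _
    rfl

theorem Complex.norm_one_add_exp_two_mul_I (θ : ℝ) :
    ‖1 + Complex.exp (2 * θ * Complex.I)‖ = 2 * |Real.cos θ| := by
  have h : 1 + Complex.exp (2 * θ * Complex.I) =
      Complex.exp (θ * Complex.I) * ((2 * Real.cos θ : ℝ) : ℂ) := by
    push_cast
    rw [Complex.two_cos, mul_add, ← Complex.exp_add, ← Complex.exp_add, add_comm]
    congr 1
    · ring_nf
    · rw [show (θ : ℂ) * Complex.I + -θ * Complex.I = 0 by ring, Complex.exp_zero]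
  rw [h, norm_mul, Complex.norm_exp_ofReal_mul_I, one_mul, Complex.norm_real, Real.norm_eq_abs,
    abs_mul, abs_two]

theorem Real.abs_cos_nat_mul_pi_div_le {q r : ℕ} (hr : 1 ≤ r) (hrq : r < q) :
    |Real.cos (r * (Real.pi / q))| ≤ Real.cos (Real.pi / q) := by
  have hq : (0 : ℝ) < q := by exact_mod_cast (by omega : 0 < q)
  have hx : 0 < Real.pi / q := div_pos Real.pi_pos hq
  have hqx : q * (Real.pi / q) = Real.pi := by field_simp
  have h1 : (1 : ℝ) ≤ r := by exact_mod_cast hr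
  have h2 : (r : ℝ) + 1 ≤ q := by exact_mod_cast hrq
  have h3 : Real.pi / q ≤ r * (Real.pi / q) := by nlinarith
  have h4 : r * (Real.pi / q) ≤ Real.pi - Real.pi / q := by nlinarith
  rw [abs_le, ← Real.cos_pi_sub]
  exact ⟨Real.cos_le_cos_of_nonneg_of_le_pi (by linarith) (by linarith) h4,
    Real.cos_le_cos_of_nonneg_of_le_pi hx.le (by linarith) h3⟩

/-- **Quantified equidistribution of binomial residue classes**: for `1 ≤ q`, `j < q`,
`N ≥ 1`, the proportion of the `2^N` total binomial mass lying on indices `≡ j (mod q)` is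
within `((q-1)/q)(cos(π/q))^N` of `1/q`. -/
theorem binomial_residue_class_equidistribution
    (q j N : ℕ) (hq : 1 ≤ q) (hj : j < q) (hN : 1 ≤ N) :
    |(1 / 2 ^ N : ℝ) *
        (∑ ℓ ∈ Finset.range (N + 1),
          if ℓ * q + j ≤ N then (N.choose (ℓ * q + j) : ℝ) else 0) - 1 / q|
      ≤ (((q : ℝ) - 1) / q) * (Real.cos (Real.pi / q)) ^ N := by
  rw [Finset.sum_range_ite_mul_add_le hj N fun k => (N.choose k : ℝ)]
  set S : ℝ := ∑ k ∈ Finset.range (N + 1), if k % q = j then (N.choose k : ℝ) else 0 with hS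
  set c : ℝ := Real.cos (Real.pi / q)
  set ζ : ℂ := Complex.exp (2 * Real.pi * Complex.I / q) with hζdef
  have hq0 : q ≠ 0 := by omega
  have hqpos : (0 : ℝ) < q := by exact_mod_cast hq
  have hζ : IsPrimitiveRoot ζ q := Complex.isPrimitiveRoot_exp q hq0
  have hnorm : ‖ζ‖ = 1 := hζ.norm'_eq_one hq0
  have hfilter : (q : ℂ) * (S : ℂ) - 2 ^ N =
      ∑ r ∈ Finset.Ico 1 q, ζ ^ (r * (q - j)) * (1 + ζ ^ r) ^ N := by
    have hcast : (S : ℂ) =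
        ∑ k ∈ Finset.range (N + 1), if k % q = j then (N.choose k : ℂ) else 0 := by
      rw [hS]
      push_cast
      exact Finset.sum_congr rfl fun k _ => by split_ifs <;> simp
    rw [hcast, ← hζ.sum_range_pow_mul_one_add_pow hj, Finset.range_eq_Ico,
      Finset.sum_eq_sum_Ico_succ_bot hq]
    norm_num
  have hterm : ∀ r ∈ Finset.Ico 1 q,
      ‖ζ ^ (r * (q - j)) * (1 + ζ ^ r) ^ N‖ ≤ (2 * c) ^ N := by
    intro r hr
    obtain ⟨h1, h2⟩ := Finset.mem_Ico.1 hr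
    have hpow : ζ ^ r = Complex.exp (2 * ((r * (Real.pi / q) : ℝ) : ℂ) * Complex.I) := by
      rw [hζdef, ← Complex.exp_nat_mul]
      push_cast
      ring_nf
    rw [norm_mul, norm_pow, norm_pow, hnorm, one_pow, one_mul, hpow,
      Complex.norm_one_add_exp_two_mul_I]
    gcongr
    exact Real.abs_cos_nat_mul_pi_div_le h1 h2
  have hbound : |q * S - 2 ^ N| ≤ (q - 1) * (2 * c) ^ N := by
    calc |q * S - 2 ^ N| = ‖(q : ℂ) * (S : ℂ) - 2 ^ N‖ := by
          rw [← Real.norm_eq_abs, ← Complex.norm_real]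
          push_cast
          rfl
      _ ≤ ∑ r ∈ Finset.Ico 1 q, (2 * c) ^ N := hfilter ▸ norm_sum_le_of_le _ hterm
      _ = (q - 1) * (2 * c) ^ N := by
          rw [Finset.sum_const, Nat.card_Ico, nsmul_eq_mul, Nat.cast_sub hq, Nat.cast_one]
  have hfactor : 1 / 2 ^ N * S - 1 / q = (q * S - 2 ^ N) / (q * 2 ^ N) := by
    field_simp
  rw [hfactor, abs_div, abs_of_pos (by positivity : (0 : ℝ) < q * 2 ^ N),
    div_le_iff₀ (by positivity)]
  calc |q * S - 2 ^ N| ≤ (q - 1) * (2 * c) ^ N := hbound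
    _ = (q - 1) / q * c ^ N * (q * 2 ^ N) := by
      rw [mul_pow]
      field_simp
end
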